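/- Let π be any m×n partial permutation matrix (not necessarily of maximal rank), let i_1 < … < i_k be the indices of its zero rows and j_1 < … < j_{n−m+k} the indices of its zero columns, and let π̄ ∈ S_{m,n} be the maximal-rank partial permutation matrix defined by π̄_{ij} = 1 iff π_{ij} = 1 or (i,j) = (i_r, j_{n−m+r}) for some 1 ≤ r ≤ k. Then {(X,Y) ∈ E : X ∈ B_- π B_+} ⊆ E_{π̄}, where B_- π B_+ := {bπc : b ∈ B_-, c ∈ B_+}. -/

import Mathlib

open Matrix

/-- The ambient space `Mat(m,n,ℂ) × Mat(n,m,ℂ)`. -/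
abbrev LUSpace (m n : ℕ) := Matrix (Fin m) (Fin n) ℂ × Matrix (Fin n) (Fin m) ℂ

/-- Lower triangular square matrix. -/
def LowerTri {k : ℕ} (M : Matrix (Fin k) (Fin k) ℂ) : Prop := ∀ i j : Fin k, i < j → M i j = 0

/-- Upper triangular square matrix. -/
def UpperTri {k : ℕ} (M : Matrix (Fin k) (Fin k) ℂ) : Prop := ∀ i j : Fin k, j < i → M i j = 0

/-- The lower-upper scheme `E`. -/
def LU (m n : ℕ) : Set (LUSpace m n) :=
  { p | LowerTri (p.1 * p.2) ∧ UpperTri (p.2 * p.1) }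

/-- The partial permutation matrix associated to `π ∈ S_{m,n}`. -/
def permMat {m n : ℕ} (π : Fin m ↪ Fin n) : Matrix (Fin m) (Fin n) ℂ :=
  fun i j => if π i = j then 1 else 0

/-- Invertible lower triangular m×m matrices. -/
def Bminus (m : ℕ) : Set (Matrix (Fin m) (Fin m) ℂ) := { b | IsUnit b ∧ LowerTri b }

/-- Invertible upper triangular n×n matrices. -/
def Bplus (n : ℕ) : Set (Matrix (Fin n) (Fin n) ℂ) := { c | IsUnit c ∧ UpperTri c }

/-- Lower unitriangular m×m matrices. -/
def Nminus (m : ℕ) : Set (Matrix (Fin m) (Fin m) ℂ) := { b | LowerTri b ∧ ∀ i, b i i = 1 }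

/-- Upper unitriangular n×n matrices. -/
def Nplus (n : ℕ) : Set (Matrix (Fin n) (Fin n) ℂ) := { c | UpperTri c ∧ ∀ j, c j j = 1 }

/-- `E°_π`. -/
def Eopen {m n : ℕ} (π : Fin m ↪ Fin n) : Set (LUSpace m n) :=
  { p | ∃ b ∈ Nminus m, ∃ c ∈ Nplus n, ∃ s t : Fin m → ℂ,
      (∀ i, s i * t i ≠ 0) ∧ (∀ i i' : Fin m, i ≠ i' → s i * t i ≠ s i' * t i') ∧
      p.1 = b * (Matrix.diagonal s * permMat π) * c⁻¹ ∧
      p.2 = c * ((permMat π)ᵀ * Matrix.diagonal t) * b⁻¹ }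

/-- Coordinates of a point of `LUSpace` as a function on the variable-index type. -/
def coordsOf {m n : ℕ} (p : LUSpace m n) : (Fin m × Fin n) ⊕ (Fin n × Fin m) → ℂ
  | .inl ij => p.1 ij.1 ij.2
  | .inr ji => p.2 ji.1 ji.2

/-- Zariski closure of a subset of `LUSpace m n`: the common zero set of all polynomials
vanishing identically on the subset. -/
def zclosure {m n : ℕ} (S : Set (LUSpace m n)) : Set (LUSpace m n) :=
  { p | ∀ f : MvPolynomial ((Fin m × Fin n) ⊕ (Fin n × Fin m)) ℂ,
      (∀ q ∈ S, MvPolynomial.eval (coordsOf q) f = 0) → MvPolynomial.eval (coordsOf p) f = 0 }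

/-- `E_π`, the Zariski closure of `E°_π`. -/
def Ecomp {m n : ℕ} (π : Fin m ↪ Fin n) : Set (LUSpace m n) := zclosure (Eopen π)

/-- Zariski closure in the matrix space `Mat(m,n,ℂ)`. -/
def mzclosure {m n : ℕ} (S : Set (Matrix (Fin m) (Fin n) ℂ)) : Set (Matrix (Fin m) (Fin n) ℂ) :=
  { X | ∀ f : MvPolynomial (Fin m × Fin n) ℂ,
      (∀ Y ∈ S, MvPolynomial.eval (fun ij => Y ij.1 ij.2) f = 0) →
        MvPolynomial.eval (fun ij => X ij.1 ij.2) f = 0 }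

lemma LowerTri.mul {k : ℕ} {M N : Matrix (Fin k) (Fin k) ℂ} (hM : LowerTri M)
    (hN : LowerTri N) : LowerTri (M * N) :=
  Matrix.BlockTriangular.mul (b := OrderDual.toDual) hM hN

lemma UpperTri.mul {k : ℕ} {M N : Matrix (Fin k) (Fin k) ℂ} (hM : UpperTri M)
    (hN : UpperTri N) : UpperTri (M * N) :=
  Matrix.BlockTriangular.mul (b := id) hM hN

lemma LowerTri.inv {k : ℕ} {M : Matrix (Fin k) (Fin k) ℂ} (hM : LowerTri M)
    (hu : IsUnit M) : LowerTri M⁻¹ := by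
  have := hu.invertible
  exact Matrix.blockTriangular_inv_of_blockTriangular (b := OrderDual.toDual) hM

lemma UpperTri.inv {k : ℕ} {M : Matrix (Fin k) (Fin k) ℂ} (hM : UpperTri M)
    (hu : IsUnit M) : UpperTri M⁻¹ := by
  have := hu.invertible
  exact Matrix.blockTriangular_inv_of_blockTriangular (b := id) hM

lemma LowerTri.isUnit_iff {k : ℕ} {M : Matrix (Fin k) (Fin k) ℂ} (hM : LowerTri M) :
    IsUnit M ↔ ∀ i, M i i ≠ 0 := by
  rw [Matrix.isUnit_iff_isUnit_det, Matrix.det_of_isLowerTriangular M hM, isUnit_iff_ne_zero,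
    Finset.prod_ne_zero_iff]
  simp

lemma UpperTri.isUnit_iff {k : ℕ} {M : Matrix (Fin k) (Fin k) ℂ} (hM : UpperTri M) :
    IsUnit M ↔ ∀ i, M i i ≠ 0 := by
  rw [Matrix.isUnit_iff_isUnit_det, Matrix.det_of_isUpperTriangular hM, isUnit_iff_ne_zero,
    Finset.prod_ne_zero_iff]
  simp

lemma LowerTri.mul_apply_self {k : ℕ} {M N : Matrix (Fin k) (Fin k) ℂ} (hM : LowerTri M)
    (hN : LowerTri N) (i : Fin k) : (M * N) i i = M i i * N i i := by
  rw [Matrix.mul_apply]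
  refine Finset.sum_eq_single i (fun j _ hj => ?_) (by simp)
  rcases lt_or_gt_of_ne hj with h | h
  · rw [hN _ _ h, mul_zero]
  · rw [hM _ _ h, zero_mul]

lemma UpperTri.mul_apply_self {k : ℕ} {M N : Matrix (Fin k) (Fin k) ℂ} (hM : UpperTri M)
    (hN : UpperTri N) (i : Fin k) : (M * N) i i = M i i * N i i := by
  rw [Matrix.mul_apply]
  refine Finset.sum_eq_single i (fun j _ hj => ?_) (by simp)
  rcases lt_or_gt_of_ne hj with h | h
  · rw [hM _ _ h, zero_mul]
  · rw [hN _ _ h, mul_zero]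

lemma lowerTri_diagonal {k : ℕ} (d : Fin k → ℂ) : LowerTri (diagonal d) :=
  fun _ _ h => diagonal_apply_ne _ h.ne

lemma upperTri_diagonal {k : ℕ} (d : Fin k → ℂ) : UpperTri (diagonal d) :=
  fun _ _ h => diagonal_apply_ne _ h.ne'

lemma Nminus.isUnit {m : ℕ} {b : Matrix (Fin m) (Fin m) ℂ} (hb : b ∈ Nminus m) : IsUnit b :=
  hb.1.isUnit_iff.2 fun i => by simp [hb.2 i]

lemma Nplus.isUnit {n : ℕ} {c : Matrix (Fin n) (Fin n) ℂ} (hc : c ∈ Nplus n) : IsUnit c :=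
  hc.1.isUnit_iff.2 fun i => by simp [hc.2 i]

/-- An invertible lower triangular matrix times a lower unitriangular one is a lower
unitriangular matrix times the diagonal of the first factor. -/
lemma exists_Nminus_mul_diagonal {m : ℕ} {b u : Matrix (Fin m) (Fin m) ℂ} (hb : b ∈ Bminus m)
    (hu : u ∈ Nminus m) :
    ∃ u' ∈ Nminus m, b * u = u' * diagonal fun i => b i i := by
  have h0 := hb.2.isUnit_iff.1 hb.1
  refine ⟨b * u * diagonal fun i => (b i i)⁻¹,
    ⟨(hb.2.mul hu.1).mul (lowerTri_diagonal _), fun i => ?_⟩, ?_⟩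
  · rw [mul_diagonal, hb.2.mul_apply_self hu.1, hu.2 i, mul_one, mul_inv_cancel₀ (h0 i)]
  · rw [Matrix.mul_assoc, diagonal_mul_diagonal]
    simp [h0]

lemma exists_Nplus_mul_diagonal {n : ℕ} {c u : Matrix (Fin n) (Fin n) ℂ} (hc : c ∈ Bplus n)
    (hu : u ∈ Nplus n) :
    ∃ u' ∈ Nplus n, c * u = u' * diagonal fun i => c i i := by
  have h0 := hc.2.isUnit_iff.1 hc.1
  refine ⟨c * u * diagonal fun i => (c i i)⁻¹,
    ⟨(hc.2.mul hu.1).mul (upperTri_diagonal _), fun i => ?_⟩, ?_⟩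
  · rw [mul_diagonal, hc.2.mul_apply_self hu.1, hu.2 i, mul_one, mul_inv_cancel₀ (h0 i)]
  · rw [Matrix.mul_assoc, diagonal_mul_diagonal]
    simp [h0]

lemma permMat_mul_apply {m n : ℕ} {l : Type*} (σ : Fin m ↪ Fin n) (Y : Matrix (Fin n) l ℂ)
    (i : Fin m) (j : l) : (permMat σ * Y) i j = Y (σ i) j := by
  simp [Matrix.mul_apply, permMat]

lemma permMat_mul_diagonal {m n : ℕ} (σ : Fin m ↪ Fin n) (d : Fin n → ℂ) :
    permMat σ * diagonal d = diagonal (fun i => d (σ i)) * permMat σ := by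
  ext i j
  rw [mul_diagonal, diagonal_mul, permMat]
  split_ifs with h <;> simp [h]

lemma diagonal_mul_transpose_permMat {m n : ℕ} (σ : Fin m ↪ Fin n) (d : Fin n → ℂ) :
    diagonal d * (permMat σ)ᵀ = (permMat σ)ᵀ * diagonal (fun i => d (σ i)) := by
  simpa using congrArg Matrix.transpose (permMat_mul_diagonal σ d)

lemma permMat_mul_transpose {m n : ℕ} (σ : Fin m ↪ Fin n) :
    permMat σ * (permMat σ)ᵀ = 1 := by
  ext i j
  rw [permMat_mul_apply, transpose_apply, permMat, one_apply]
  simp [σ.injective.eq_iff, eq_comm]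

lemma mul_permMat_apply {m n : ℕ} {l : Type*} (σ : Fin m ↪ Fin n) (Z : Matrix l (Fin m) ℂ)
    (j : l) (i : Fin m) : (Z * permMat σ) j (σ i) = Z j i := by
  simp [Matrix.mul_apply, permMat, σ.injective.eq_iff]

lemma mul_permMat_apply_of_notMem {m n : ℕ} {l : Type*} (σ : Fin m ↪ Fin n)
    (Z : Matrix l (Fin m) ℂ) (j : l) {j' : Fin n} (h : ∀ i, σ i ≠ j') :
    (Z * permMat σ) j j' = 0 := by
  simp [Matrix.mul_apply, permMat, h]

/-- `E°_σ` is stable under `B_- × B_+`. -/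
lemma Eopen_smul_mem {m n : ℕ} (σ : Fin m ↪ Fin n) {b : Matrix (Fin m) (Fin m) ℂ}
    {c : Matrix (Fin n) (Fin n) ℂ} (hb : b ∈ Bminus m) (hc : c ∈ Bplus n) {p : LUSpace m n}
    (hp : p ∈ Eopen σ) : ((b * p.1 * c⁻¹, c * p.2 * b⁻¹) : LUSpace m n) ∈ Eopen σ := by
  obtain ⟨u, hu, v, hv, s, t, hst, hst', h1, h2⟩ := hp
  obtain ⟨u', hu', hbu⟩ := exists_Nminus_mul_diagonal hb hu
  obtain ⟨v', hv', hcv⟩ := exists_Nplus_mul_diagonal hc hv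
  have hb0 := hb.2.isUnit_iff.1 hb.1
  have hc0 := hc.2.isUnit_iff.1 hc.1
  have key : ∀ i, (b i i * s i * (c (σ i) (σ i))⁻¹) * (c (σ i) (σ i) * t i * (b i i)⁻¹)
      = s i * t i := fun i => by
    have := hb0 i
    have := hc0 (σ i)
    field_simp
  have hbi : u⁻¹ * b⁻¹ = diagonal (fun i => (b i i)⁻¹) * u'⁻¹ := by
    rw [← Matrix.mul_inv_rev, hbu, Matrix.mul_inv_rev]
    congr 1
    refine Matrix.inv_eq_left_inv ?_
    simp [diagonal_mul_diagonal, hb0]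
  have hci : v⁻¹ * c⁻¹ = diagonal (fun i => (c i i)⁻¹) * v'⁻¹ := by
    rw [← Matrix.mul_inv_rev, hcv, Matrix.mul_inv_rev]
    congr 1
    refine Matrix.inv_eq_left_inv ?_
    simp [diagonal_mul_diagonal, hc0]
  refine ⟨u', hu', v', hv', fun i => b i i * s i * (c (σ i) (σ i))⁻¹,
    fun i => c (σ i) (σ i) * t i * (b i i)⁻¹, fun i => by rw [key]; exact hst i,
    fun i i' h => by rw [key, key]; exact hst' i i' h, ?_, ?_⟩
  · calc b * p.1 * c⁻¹ = (b * u) * (diagonal s * permMat σ) * (v⁻¹ * c⁻¹) := by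
          simp only [h1, Matrix.mul_assoc]
      _ = u' * (diagonal (fun i => b i i) * diagonal s *
            (permMat σ * diagonal fun i => (c i i)⁻¹)) * v'⁻¹ := by
          simp only [hbu, hci, Matrix.mul_assoc]
      _ = _ := by
          rw [permMat_mul_diagonal, ← Matrix.mul_assoc (_ * _) (diagonal _),
            diagonal_mul_diagonal, diagonal_mul_diagonal]
  · calc c * p.2 * b⁻¹ = (c * v) * ((permMat σ)ᵀ * diagonal t) * (u⁻¹ * b⁻¹) := by
          simp only [h2, Matrix.mul_assoc]
      _ = v' * ((diagonal (fun i => c i i) * (permMat σ)ᵀ) *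
            (diagonal t * diagonal fun i => (b i i)⁻¹)) * u'⁻¹ := by
          simp only [hcv, hbi, Matrix.mul_assoc]
      _ = _ := by
          rw [diagonal_mul_transpose_permMat, Matrix.mul_assoc (permMat σ)ᵀ,
            diagonal_mul_diagonal, diagonal_mul_diagonal]
          simp only [mul_assoc]

/-- The Euclidean closure of `E°_σ` is stable under `B_- × B_+`. -/
lemma mem_closure_Eopen_of_smul {m n : ℕ} (σ : Fin m ↪ Fin n) {b : Matrix (Fin m) (Fin m) ℂ}
    {c : Matrix (Fin n) (Fin n) ℂ} (hb : b ∈ Bminus m) (hc : c ∈ Bplus n)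
    {X X' : Matrix (Fin m) (Fin n) ℂ} {Y Y' : Matrix (Fin n) (Fin m) ℂ}
    (hp : ((X', Y') : LUSpace m n) ∈ closure (Eopen σ)) (hX : X * c = b * X')
    (hY : Y * b = c * Y') : ((X, Y) : LUSpace m n) ∈ closure (Eopen σ) := by
  have hcont : Continuous fun p : LUSpace m n =>
      ((b * p.1 * c⁻¹, c * p.2 * b⁻¹) : LUSpace m n) := by fun_prop
  have h := map_mem_closure hcont hp (fun q hq => Eopen_smul_mem σ hb hc hq)
  have hb' := (Matrix.isUnit_iff_isUnit_det b).1 hb.1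
  have hc' := (Matrix.isUnit_iff_isUnit_det c).1 hc.1
  rwa [← hX, ← hY, Matrix.mul_nonsing_inv_cancel_right _ _ hc',
    Matrix.mul_nonsing_inv_cancel_right _ _ hb'] at h

lemma closure_subset_zclosure {m n : ℕ} (S : Set (LUSpace m n)) : closure S ⊆ zclosure S := by
  refine closure_minimal (fun p hp f hf => hf p hp) ?_
  have hcoords : Continuous (coordsOf : LUSpace m n → _) := by
    refine continuous_pi fun x => ?_
    rcases x with ij | ji
    · exact (continuous_fst.matrix_elem ij.1 ij.2)
    · exact (continuous_snd.matrix_elem ji.1 ji.2)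
  have : zclosure S = ⋂ f ∈ {f : MvPolynomial ((Fin m × Fin n) ⊕ (Fin n × Fin m)) ℂ |
      ∀ q ∈ S, MvPolynomial.eval (coordsOf q) f = 0},
      {p | MvPolynomial.eval (coordsOf p) f = 0} := by
    ext p
    simp [zclosure]
  rw [this]
  exact isClosed_biInter fun f _ =>
    isClosed_eq ((MvPolynomial.continuous_eval f).comp hcoords) continuous_const

/-- A lower triangular matrix with distinct diagonal entries is diagonalized by a lower
unitriangular matrix. -/
lemma LowerTri.exists_Nminus_diagonalize {m : ℕ} {L : Matrix (Fin m) (Fin m) ℂ}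
    (hL : LowerTri L) (hd : ∀ i i', i ≠ i' → L i i ≠ L i' i') :
    ∃ b ∈ Nminus m, L * b = b * diagonal fun i => L i i := by
  have hex : ∀ i, ∃ w : Fin m → ℂ, w i = 1 ∧ (∀ j < i, w j = 0) ∧ L *ᵥ w = L i i • w := by
    intro i
    have hT : LowerTri (L - diagonal fun _ => L i i) := fun j j' h => by
      simp [hL _ _ h, h.ne]
    have hdet : (L - diagonal fun _ => L i i).det = 0 := by
      rw [Matrix.det_of_isLowerTriangular _ hT]
      exact Finset.prod_eq_zero (Finset.mem_univ i) (by simp)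
    obtain ⟨w, hw0, hw⟩ := Matrix.exists_mulVec_eq_zero_iff.2 hdet
    have hw' : L *ᵥ w = L i i • w := by
      rw [Matrix.sub_mulVec, sub_eq_zero] at hw
      rw [hw]
      ext j
      simp [Matrix.mulVec_diagonal]
    have hlow : ∀ j, (∀ j' < j, w j' = 0) → j ≠ i → w j = 0 := by
      intro j hj hji
      have h1 := congrFun hw' j
      have h2 : (L *ᵥ w) j = L j j * w j := by
        rw [Matrix.mulVec, dotProduct]
        refine Finset.sum_eq_single j (fun j' _ hj' => ?_) (by simp)
        rcases lt_or_gt_of_ne hj' with h | h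
        · rw [hj _ h, mul_zero]
        · rw [hL _ _ h, zero_mul]
      rw [h2, Pi.smul_apply, smul_eq_mul] at h1
      exact (mul_eq_mul_right_iff.1 h1).resolve_left (hd _ _ hji)
    have hlt : ∀ j < i, w j = 0 := by
      intro j
      induction j using WellFoundedLT.induction with
      | ind j ih => exact fun hj => hlow j (fun j' h => ih j' h (h.trans hj)) hj.ne
    have hwi : w i ≠ 0 := by
      intro hwi
      refine hw0 (funext fun j => ?_)
      induction j using WellFoundedLT.induction with
      | ind j ih =>
        by_cases hji : j = i
        · rw [hji, hwi, Pi.zero_apply]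
        · exact hlow j ih hji
    refine ⟨(w i)⁻¹ • w, by simp [hwi], fun j hj => by simp [hlt j hj], ?_⟩
    rw [Matrix.mulVec_smul, hw', smul_comm]
  choose w hw1 hw2 hw3 using hex
  refine ⟨Matrix.of fun j i => w i j, ⟨fun i j h => hw2 j i h, hw1⟩, ?_⟩
  ext j i
  have := congrFun (hw3 i) j
  rw [mul_diagonal]
  simpa [Matrix.mul_apply, Matrix.mulVec, dotProduct, mul_comm] using this

/-- An eigenvector of an upper triangular matrix is supported up to the last diagonal position
holding its eigenvalue. -/
lemma UpperTri.eigenvector_apply_eq_zero {n : ℕ} {M : Matrix (Fin n) (Fin n) ℂ} (hM : UpperTri M)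
    {v : Fin n → ℂ} {d : ℂ} (hv : M *ᵥ v = d • v) {j₀ : Fin n} (hd : ∀ j, j₀ < j → M j j ≠ d)
    {j : Fin n} (hj : j₀ < j) : v j = 0 := by
  induction j using WellFoundedGT.induction with
  | ind j ih =>
    have h1 := congrFun hv j
    have h2 : (M *ᵥ v) j = M j j * v j := by
      rw [Matrix.mulVec, dotProduct]
      refine Finset.sum_eq_single j (fun j' _ hj' => ?_) (by simp)
      rcases lt_or_gt_of_ne hj' with h | h
      · rw [hM _ _ h, zero_mul]
      · rw [ih _ h (hj.trans h), mul_zero]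
    rw [h2, Pi.smul_apply, smul_eq_mul] at h1
    exact (mul_eq_mul_right_iff.1 h1).resolve_left (hd _ hj)

lemma diagonal_mul_permMat_mul_apply {m n : ℕ} {l : Type*} (σ : Fin m ↪ Fin n) (s : Fin m → ℂ)
    (Y : Matrix (Fin n) l ℂ) (i : Fin m) (j : l) :
    (diagonal s * permMat σ * Y) i j = s i * Y (σ i) j := by
  rw [Matrix.mul_assoc, diagonal_mul, permMat_mul_apply]

lemma mul_diagonal_mul_permMat_apply {m n : ℕ} {l : Type*} (σ : Fin m ↪ Fin n) (s : Fin m → ℂ)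
    (Y : Matrix l (Fin m) ℂ) (j : l) (i : Fin m) :
    (Y * (diagonal s * permMat σ)) j (σ i) = Y j i * s i := by
  rw [← Matrix.mul_assoc, mul_permMat_apply, mul_diagonal]

/-- Entrywise description of the points of `E` whose first coordinate is a scaled partial
permutation matrix. -/
lemma mem_LU_diagonal_mul_permMat_iff {m n : ℕ} (σ : Fin m ↪ Fin n) (s : Fin m → ℂ)
    (Y : Matrix (Fin n) (Fin m) ℂ) :
    ((diagonal s * permMat σ, Y) : LUSpace m n) ∈ LU m n ↔
      ∀ i, s i ≠ 0 → (∀ i', i < i' → Y (σ i) i' = 0) ∧ ∀ j, σ i < j → Y j i = 0 := by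
  constructor
  · rintro ⟨h1, h2⟩ i hi
    refine ⟨fun i' h => ?_, fun j h => ?_⟩
    · have := h1 i i' h
      rw [diagonal_mul_permMat_mul_apply] at this
      exact (mul_eq_zero.1 this).resolve_left hi
    · have := h2 j (σ i) h
      rw [mul_diagonal_mul_permMat_apply] at this
      exact (mul_eq_zero.1 this).resolve_right hi
  · intro H
    refine ⟨fun i i' h => ?_, fun j j' h => ?_⟩
    · change (diagonal s * permMat σ * Y) i i' = 0
      rw [diagonal_mul_permMat_mul_apply]
      by_cases hi : s i = 0
      · rw [hi, zero_mul]
      · rw [(H i hi).1 i' h, mul_zero]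
    · change (Y * (diagonal s * permMat σ)) j j' = 0
      by_cases hj' : ∃ i, σ i = j'
      · obtain ⟨i, rfl⟩ := hj'
        rw [mul_diagonal_mul_permMat_apply]
        by_cases hi : s i = 0
        · rw [hi, mul_zero]
        · rw [(H i hi).2 j h, zero_mul]
      · rw [← Matrix.mul_assoc]
        exact mul_permMat_apply_of_notMem σ _ _ (not_exists.1 hj')

/-- A point of `E` whose first coordinate is a scaled permutation matrix of maximal rank and
whose product `X * Y` has distinct nonzero diagonal entries lies in `E°_σ`. -/
lemma mem_Eopen_of_distinct {m n : ℕ} (σ : Fin m ↪ Fin n) {s : Fin m → ℂ} (hs : ∀ i, s i ≠ 0)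
    {Y : Matrix (Fin n) (Fin m) ℂ}
    (hp : ((diagonal s * permMat σ, Y) : LUSpace m n) ∈ LU m n)
    (h0 : ∀ i, s i * Y (σ i) i ≠ 0)
    (hne : ∀ i i', i ≠ i' → s i * Y (σ i) i ≠ s i' * Y (σ i') i') :
    ((diagonal s * permMat σ, Y) : LUSpace m n) ∈ Eopen σ := by
  set X := diagonal s * permMat σ with hX
  set d : Fin m → ℂ := fun i => s i * Y (σ i) i with hd
  have hL : LowerTri (X * Y) := hp.1
  have hU : UpperTri (Y * X) := hp.2
  have hdiag : ∀ i, (X * Y) i i = d i := fun i => diagonal_mul_permMat_mul_apply σ s Y i i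
  obtain ⟨b, hb, hLb⟩ := hL.exists_Nminus_diagonalize fun i i' h => by
    rw [hdiag, hdiag]; exact hne i i' h
  simp only [hdiag] at hLb
  have hbu := (Matrix.isUnit_iff_isUnit_det b).1 (Nminus.isUnit hb)
  -- the columns of `Y * b` are eigenvectors of `Y * X`
  have hYb : ∀ i j, σ i < j → (Y * b) j i = 0 := by
    intro i j hj
    have hv : (Y * X) *ᵥ (fun j => (Y * b) j i) = d i • fun j => (Y * b) j i := by
      have h : Y * X * (Y * b) = Y * b * diagonal d := by
        simp only [Matrix.mul_assoc] at hLb ⊢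
        rw [hLb]
      ext j
      have := congrFun (congrFun h j) i
      rw [mul_diagonal] at this
      simpa [Matrix.mul_apply, Matrix.mulVec, dotProduct, mul_comm] using this
    refine hU.eigenvector_apply_eq_zero hv (fun j' hj' => ?_) hj
    by_cases hex : ∃ i', σ i' = j'
    · obtain ⟨i', rfl⟩ := hex
      rw [hX, mul_diagonal_mul_permMat_apply, mul_comm]
      exact hne i' i (by rintro rfl; exact hj'.false)
    · rw [hX, ← Matrix.mul_assoc, mul_permMat_apply_of_notMem σ _ _ (not_exists.1 hex)]
      exact (h0 i).symm
  have hXYb : X * (Y * b) = b * diagonal d := by rw [← Matrix.mul_assoc, hLb]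
  have hYbσ : ∀ i, (Y * b) (σ i) i = Y (σ i) i := by
    intro i
    have h := congrFun (congrFun hXYb i) i
    rw [hX, diagonal_mul_permMat_mul_apply, mul_diagonal, hb.2 i, one_mul] at h
    exact mul_left_cancel₀ (hs i) h
  set t : Fin m → ℂ := fun i => Y (σ i) i with ht
  have ht0 : ∀ i, t i ≠ 0 := fun i => right_ne_zero_of_mul (h0 i)
  set c : Matrix (Fin n) (Fin n) ℂ :=
    1 - (permMat σ)ᵀ * permMat σ + Y * b * diagonal (fun i => (t i)⁻¹) * permMat σ with hc
  have hcσ : c * (permMat σ)ᵀ = Y * b * diagonal (fun i => (t i)⁻¹) := by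
    rw [hc, Matrix.add_mul, Matrix.sub_mul, Matrix.mul_assoc (permMat σ)ᵀ,
      Matrix.mul_assoc _ (permMat σ), permMat_mul_transpose]
    simp
  have hXc : X * c = b * X := by
    have h1 : X * (1 - (permMat σ)ᵀ * permMat σ) = 0 := by
      rw [hX, Matrix.mul_assoc, Matrix.mul_sub, ← Matrix.mul_assoc (permMat σ) _ (permMat σ),
        permMat_mul_transpose]
      simp
    rw [hc, Matrix.mul_add, h1, zero_add, ← Matrix.mul_assoc, ← Matrix.mul_assoc, hXYb,
      Matrix.mul_assoc b, diagonal_mul_diagonal, hX, ← Matrix.mul_assoc]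
    congr 3
    ext i
    simp [hd, ht, show Y (σ i) i ≠ 0 from ht0 i]
  have hcapp : ∀ j i, c j (σ i) = (Y * b) j i * (t i)⁻¹ := by
    intro j i
    have h := congrFun (congrFun hcσ j) i
    rw [mul_diagonal] at h
    rw [← h]
    simp [Matrix.mul_apply, permMat]
  have hcapp' : ∀ j j', (∀ i, σ i ≠ j') → c j j' = if j = j' then 1 else 0 := by
    intro j j' h
    rw [hc, Matrix.add_apply, Matrix.sub_apply, mul_permMat_apply_of_notMem σ _ _ h,
      mul_permMat_apply_of_notMem σ _ _ h, one_apply]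
    simp
  have hcN : c ∈ Nplus n := by
    refine ⟨fun j j' h => ?_, fun j => ?_⟩
    · by_cases hex : ∃ i, σ i = j'
      · obtain ⟨i, rfl⟩ := hex
        rw [hcapp, hYb i j h, zero_mul]
      · rw [hcapp' _ _ (not_exists.1 hex), if_neg h.ne']
    · by_cases hex : ∃ i, σ i = j
      · obtain ⟨i, rfl⟩ := hex
        rw [hcapp, hYbσ, mul_inv_cancel₀ (ht0 i)]
      · rw [hcapp' _ _ (not_exists.1 hex), if_pos rfl]
  have hcu := (Matrix.isUnit_iff_isUnit_det c).1 (Nplus.isUnit hcN)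
  refine ⟨b, hb, c, hcN, s, t, h0, hne, ?_, ?_⟩
  · change X = b * X * c⁻¹
    rw [← hXc, Matrix.mul_nonsing_inv_cancel_right _ _ hcu]
  · change Y = _
    rw [← Matrix.mul_assoc, hcσ, Matrix.mul_assoc (Y * b), diagonal_mul_diagonal]
    simp only [inv_mul_cancel₀ (ht0 _), diagonal_one, Matrix.mul_one]
    rw [Matrix.mul_nonsing_inv_cancel_right _ _ hbu]

lemma eventually_add_mul_ne_zero (a : ℂ) {w : ℂ} (hw : w ≠ 0) :
    ∀ᶠ ε in nhdsWithin (0 : ℂ) {0}ᶜ, a + ε * w ≠ 0 := by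
  by_cases ha : a = 0
  · filter_upwards [self_mem_nhdsWithin] with ε hε
    simpa [ha, hw] using hε
  · have hc : Continuous fun ε : ℂ => a + ε * w := by fun_prop
    exact (hc.continuousAt.eventually_ne (by simpa using ha)).filter_mono nhdsWithin_le_nhds

lemma mem_closure_of_eventually {α : Type*} [TopologicalSpace α] {S : Set α} {γ : ℂ → α}
    (hγ : Continuous γ) (h : ∀ᶠ ε in nhdsWithin (0 : ℂ) {0}ᶜ, γ ε ∈ closure S) :
    γ 0 ∈ closure S :=
  isClosed_closure.mem_of_tendsto (hγ.tendsto 0 |>.mono_left nhdsWithin_le_nhds) h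

/-- To put the points of `E` over a scaled partial permutation matrix in a closure, it suffices to
treat those for which the diagonal entries of `X * Y` on the nonzero rows are distinct and
nonzero. -/
lemma mem_closure_of_forall_distinct {m n : ℕ} (σ : Fin m ↪ Fin n) {s : Fin m → ℂ}
    {S : Set (LUSpace m n)}
    (H : ∀ Y : Matrix (Fin n) (Fin m) ℂ,
      ((diagonal s * permMat σ, Y) : LUSpace m n) ∈ LU m n →
      (∀ i, s i ≠ 0 → s i * Y (σ i) i ≠ 0) →
      (∀ i i', s i ≠ 0 → s i' ≠ 0 → i ≠ i' → s i * Y (σ i) i ≠ s i' * Y (σ i') i') →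
      ((diagonal s * permMat σ, Y) : LUSpace m n) ∈ closure S)
    {Y : Matrix (Fin n) (Fin m) ℂ}
    (hp : ((diagonal s * permMat σ, Y) : LUSpace m n) ∈ LU m n) :
    ((diagonal s * permMat σ, Y) : LUSpace m n) ∈ closure S := by
  set w : Fin m → ℂ := fun i => ((i : ℕ) + 1 : ℂ) / s i with hw
  set Z : ℂ → Matrix (Fin n) (Fin m) ℂ := fun ε => Y + ε • ((permMat σ)ᵀ * diagonal w) with hZ
  have hZapp : ∀ ε j i, Z ε j i = Y j i + ε * if σ i = j then w i else 0 := by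
    intro ε j i
    simp [hZ, mul_diagonal, permMat]
  have hZσ : ∀ ε i, s i ≠ 0 → s i * Z ε (σ i) i = s i * Y (σ i) i + ε * ((i : ℕ) + 1) := by
    intro ε i hi
    rw [hZapp, if_pos rfl, hw]
    field_simp
  have h0 : ∀ᶠ ε in nhdsWithin (0 : ℂ) {0}ᶜ, ∀ i, s i ≠ 0 → s i * Z ε (σ i) i ≠ 0 := by
    refine Filter.eventually_all.2 fun i => ?_
    filter_upwards [eventually_add_mul_ne_zero (s i * Y (σ i) i)
      (Nat.cast_add_one_ne_zero (R := ℂ) (i : ℕ))] with ε hε hi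
    rwa [hZσ _ _ hi]
  have hne : ∀ᶠ ε in nhdsWithin (0 : ℂ) {0}ᶜ, ∀ i i', s i ≠ 0 → s i' ≠ 0 → i ≠ i' →
      s i * Z ε (σ i) i ≠ s i' * Z ε (σ i') i' := by
    refine Filter.eventually_all.2 fun i => Filter.eventually_all.2 fun i' => ?_
    by_cases hii : i = i'
    · exact Filter.Eventually.of_forall fun _ _ _ h => absurd hii h
    · have hw' : ((i : ℕ) - (i' : ℕ) : ℂ) ≠ 0 := by
        rw [sub_ne_zero]
        exact_mod_cast fun h => hii (Fin.ext h)
      filter_upwards [eventually_add_mul_ne_zero (s i * Y (σ i) i - s i' * Y (σ i') i') hw']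
        with ε hε hi hi' _ heq
      rw [hZσ _ _ hi, hZσ _ _ hi'] at heq
      exact hε (by linear_combination heq)
  have hγ : Continuous fun ε : ℂ => ((diagonal s * permMat σ, Z ε) : LUSpace m n) := by
    fun_prop
  have := mem_closure_of_eventually (S := S) hγ <| by
    filter_upwards [h0, hne] with ε h1 h2
    refine H _ ?_ h1 h2
    rw [mem_LU_diagonal_mul_permMat_iff] at hp ⊢
    refine fun i hi => ⟨fun i' h => ?_, fun j h => ?_⟩
    · rw [hZapp, (hp i hi).1 i' h, if_neg (by simpa using h.ne')]
      simp
    · rw [hZapp, (hp i hi).2 j h, if_neg h.ne]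
      simp
  simpa [hZ] using this

/-- A lower triangular system restricted to a set of indices with nonzero diagonal entries is
solvable. -/
lemma exists_solution_of_triangular {m : ℕ} {M : Matrix (Fin m) (Fin m) ℂ} (S : Finset (Fin m))
    (hM : ∀ i ∈ S, ∀ i', i < i' → M i i' = 0) (hd : ∀ i ∈ S, M i i ≠ 0) (v : Fin m → ℂ) :
    (∃ β : Fin m → ℂ, (∀ i ∉ S, β i = 0) ∧ ∀ i ∈ S, (M *ᵥ β) i = v i) ∧
      ∃ α : Fin m → ℂ, (∀ i ∉ S, α i = 0) ∧ ∀ i ∈ S, (α ᵥ* M) i = v i := by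
  classical
  set A : Matrix (Fin m) (Fin m) ℂ := fun i i' =>
    if i ∈ S ∧ i' ∈ S then M i i' else if i = i' then 1 else 0 with hA
  have hAl : LowerTri A := by
    intro i i' h
    simp only [hA]
    split_ifs with h1 h2
    · exact hM i h1.1 i' h
    · exact absurd h2 h.ne
    · rfl
  have hu : IsUnit A := hAl.isUnit_iff.2 fun i => by
    simp only [hA]
    split_ifs with h1
    · exact hd i h1.1
    · simp
  rw [Matrix.isUnit_iff_isUnit_det] at hu
  set v' : Fin m → ℂ := fun i => if i ∈ S then v i else 0 with hv'
  refine ⟨⟨A⁻¹ *ᵥ v', ?_⟩, ⟨v' ᵥ* A⁻¹, ?_⟩⟩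
  · set β := A⁻¹ *ᵥ v'
    have h : A *ᵥ β = v' := by
      rw [Matrix.mulVec_mulVec, Matrix.mul_nonsing_inv _ hu, Matrix.one_mulVec]
    have hβ : ∀ i ∉ S, β i = 0 := fun i hi => by
      have := congrFun h i
      simpa [Matrix.mulVec, dotProduct, hA, hi, hv'] using this
    refine ⟨hβ, fun i hi => ?_⟩
    have h' := congrFun h i
    rw [hv'] at h'
    simp only [hi, if_true] at h'
    rw [← h']
    simp only [Matrix.mulVec, dotProduct]
    refine Finset.sum_congr rfl fun i' _ => ?_
    by_cases hi' : i' ∈ S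
    · simp [hA, hi, hi']
    · rw [hβ i' hi', mul_zero, mul_zero]
  · set α := v' ᵥ* A⁻¹
    have h : α ᵥ* A = v' := by
      rw [Matrix.vecMul_vecMul, Matrix.nonsing_inv_mul _ hu, Matrix.vecMul_one]
    have hα : ∀ i ∉ S, α i = 0 := fun i hi => by
      have := congrFun h i
      simpa [Matrix.vecMul, dotProduct, hA, hi, hv'] using this
    refine ⟨hα, fun i hi => ?_⟩
    have h' := congrFun h i
    rw [hv'] at h'
    simp only [hi, if_true] at h'
    rw [← h']
    simp only [Matrix.vecMul, dotProduct]
    refine Finset.sum_congr rfl fun i' _ => ?_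
    by_cases hi' : i' ∈ S
    · simp [hA, hi, hi']
    · rw [hα i' hi', zero_mul, zero_mul]

lemma one_add_vecMulVec_mem_Bplus {n : ℕ} {j₀ : Fin n} {u : Fin n → ℂ}
    (hu : ∀ j, j ≤ j₀ → u j = 0) : 1 + vecMulVec (Pi.single j₀ 1) u ∈ Bplus n := by
  have hN : 1 + vecMulVec (Pi.single j₀ 1) u ∈ Nplus n := by
    refine ⟨fun j j' h => ?_, fun j => ?_⟩
    · by_cases hj : j = j₀
      · subst hj
        simp [vecMulVec_apply, h.ne', hu j' h.le]
      · simp [vecMulVec_apply, h.ne', hj]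
    · by_cases hj : j = j₀
      · subst hj
        simp [vecMulVec_apply, hu j le_rfl]
      · simp [vecMulVec_apply, hj]
  exact ⟨Nplus.isUnit hN, hN.1⟩

lemma one_add_vecMulVec_mem_Bminus {m : ℕ} {i₀ : Fin m} {β : Fin m → ℂ}
    (hβ : ∀ i, i ≤ i₀ → β i = 0) : 1 + vecMulVec β (Pi.single i₀ 1) ∈ Bminus m := by
  have hN : 1 + vecMulVec β (Pi.single i₀ 1) ∈ Nminus m := by
    refine ⟨fun i i' h => ?_, fun i => ?_⟩
    · by_cases hi : i' = i₀
      · subst hi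
        simp [vecMulVec_apply, h.ne, hβ i h.le]
      · simp [vecMulVec_apply, h.ne, hi]
    · by_cases hi : i = i₀
      · subst hi
        simp [vecMulVec_apply, hβ i le_rfl]
      · simp [vecMulVec_apply, hi]
  exact ⟨Nminus.isUnit hN, hN.1⟩

/-- Up to the action of `B_- × B_+`, a point of `E` over a scaled partial permutation matrix with
last zero row `i₀` can be moved, without changing the first coordinate, so that activating the
entry `(i₀, σ i₀)` stays in `E`. -/
lemma exists_smul_update_mem_LU {m n : ℕ} (σ : Fin m ↪ Fin n) {s : Fin m → ℂ} {i₀ : Fin m}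
    (hi₀ : s i₀ = 0) (hrow : ∀ i, i₀ < i → s i ≠ 0)
    (hcol : ∀ j, σ i₀ < j → ∃ i, σ i = j ∧ s i ≠ 0) {Y : Matrix (Fin n) (Fin m) ℂ}
    (hp : ((diagonal s * permMat σ, Y) : LUSpace m n) ∈ LU m n)
    (hd : ∀ i, s i ≠ 0 → Y (σ i) i ≠ 0) :
    ∃ b ∈ Bminus m, ∃ c ∈ Bplus n, ∃ Y' : Matrix (Fin n) (Fin m) ℂ,
      diagonal s * permMat σ * c = b * (diagonal s * permMat σ) ∧ Y * b = c * Y' ∧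
      ∀ ε : ℂ, ((diagonal (Function.update s i₀ ε) * permMat σ, Y') : LUSpace m n) ∈ LU m n := by
  have hp' := (mem_LU_diagonal_mul_permMat_iff σ s Y).1 hp
  set j₀ := σ i₀ with hj₀
  set S : Finset (Fin m) := {i | i₀ < i ∧ j₀ < σ i} with hS
  have hmem : ∀ i, i ∈ S ↔ i₀ < i ∧ j₀ < σ i := fun i => by simp [hS]
  have hSs : ∀ i ∈ S, s i ≠ 0 := fun i hi => hrow i ((hmem i).1 hi).1
  have hM : ∀ i ∈ S, ∀ i', i < i' → (permMat σ * Y) i i' = 0 := fun i hi i' h => by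
    rw [permMat_mul_apply, (hp' i (hSs i hi)).1 i' h]
  have hMd : ∀ i ∈ S, (permMat σ * Y) i i ≠ 0 := fun i hi => by
    rw [permMat_mul_apply]; exact hd i (hSs i hi)
  obtain ⟨β, hβ, hβ'⟩ := (exists_solution_of_triangular S hM hMd fun i => - Y (σ i) i₀).1
  obtain ⟨α, hα, hα'⟩ := (exists_solution_of_triangular S hM hMd fun i => Y j₀ i).2
  set u : Fin n → ℂ := α ᵥ* permMat σ with hu
  set N : Matrix (Fin n) (Fin n) ℂ := vecMulVec (Pi.single j₀ 1) u with hN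
  set K : Matrix (Fin m) (Fin m) ℂ := vecMulVec β (Pi.single i₀ 1) with hK
  have hu0 : ∀ j, j ≤ j₀ → u j = 0 := by
    intro j hj
    rw [hu, Matrix.vecMul, dotProduct]
    refine Finset.sum_eq_zero fun i _ => ?_
    by_cases hi : i ∈ S
    · have : σ i ≠ j := ((hj.trans_lt ((hmem i).1 hi).2)).ne'
      simp [permMat, this]
    · simp [hα i hi]
  have hβ0 : ∀ i, i ≤ i₀ → β i = 0 := fun i hi =>
    hβ i fun h => absurd ((hmem i).1 h).1 hi.not_gt
  have hNN : N * N = 0 := by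
    rw [hN, vecMulVec_mul_vecMulVec]
    simp [hu0 j₀ le_rfl]
  have hXN : diagonal s * permMat σ * N = 0 := by
    ext i j
    rw [diagonal_mul_permMat_mul_apply, hN, vecMulVec_apply]
    by_cases hi : i = i₀
    · simp [hi, hi₀]
    · simp [hj₀, σ.injective.eq_iff, hi]
  have hKX : K * (diagonal s * permMat σ) = 0 := by
    rw [← Matrix.mul_assoc, hK]
    have : vecMulVec β (Pi.single i₀ 1) * diagonal s = 0 := by
      ext i i'
      rw [mul_diagonal, vecMulVec_apply]
      by_cases hi : i' = i₀
      · simp [hi, hi₀]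
      · simp [hi]
    rw [this, Matrix.zero_mul]
  have hb := one_add_vecMulVec_mem_Bminus hβ0
  have hc := one_add_vecMulVec_mem_Bplus hu0
  have hc' : UpperTri (1 - N) := by
    have := (one_add_vecMulVec_mem_Bplus (u := -u) (j₀ := j₀) fun j hj => by
      simp [hu0 j hj]).2
    rwa [vecMulVec_neg, ← sub_eq_add_neg] at this
  set Y' := (1 - N) * Y * (1 + K) with hY'
  have hLU' : ((diagonal s * permMat σ, Y') : LUSpace m n) ∈ LU m n := by
    constructor
    · have : diagonal s * permMat σ * Y' = diagonal s * permMat σ * Y * (1 + K) := by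
        rw [hY', ← Matrix.mul_assoc, ← Matrix.mul_assoc, Matrix.mul_sub, hXN]
        simp
      change LowerTri (diagonal s * permMat σ * Y')
      rw [this]
      exact LowerTri.mul hp.1 hb.2
    · have : Y' * (diagonal s * permMat σ) = (1 - N) * (Y * (diagonal s * permMat σ)) := by
        rw [hY', Matrix.mul_assoc, Matrix.add_mul, hKX]
        simp [Matrix.mul_assoc]
      change UpperTri (Y' * (diagonal s * permMat σ))
      rw [this]
      exact UpperTri.mul hc' hp.2
  have hNY : ∀ j i, (N * Y) j i = if j = j₀ then (α ᵥ* (permMat σ * Y)) i else 0 := by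
    intro j i
    rw [hN, vecMulVec_mul, hu, Matrix.vecMul_vecMul, vecMulVec_apply]
    by_cases hj : j = j₀ <;> simp [hj]
  have hZK : ∀ (Z : Matrix (Fin n) (Fin m) ℂ) j i,
      (Z * K) j i = if i = i₀ then (Z *ᵥ β) j else 0 := by
    intro Z j i
    rw [hK, mul_vecMulVec, vecMulVec_apply]
    by_cases hi : i = i₀ <;> simp [hi]
  have hYr : ∀ i, i₀ < i → Y' j₀ i = 0 := by
    intro i hi
    rw [hY', Matrix.mul_add, Matrix.mul_one, Matrix.add_apply, hZK, if_neg hi.ne', add_zero,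
      Matrix.sub_mul, Matrix.one_mul, Matrix.sub_apply, hNY, if_pos rfl, sub_eq_zero]
    by_cases hiS : i ∈ S
    · exact (hα' i hiS).symm
    · have hlt : σ i < j₀ := by
        refine lt_of_le_of_ne (not_lt.1 fun h => hiS ((hmem i).2 ⟨hi, h⟩)) ?_
        rw [hj₀, σ.injective.ne_iff]
        exact hi.ne'
      rw [(hp' i (hrow i hi)).2 j₀ hlt]
      rw [Matrix.vecMul, dotProduct, eq_comm]
      refine Finset.sum_eq_zero fun i' _ => ?_
      by_cases hi' : i' ∈ S
      · rw [permMat_mul_apply, (hp' i (hrow i hi)).2 _ (hlt.trans ((hmem i').1 hi').2), mul_zero]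
      · rw [hα i' hi', zero_mul]
  have hYc : ∀ j, j₀ < j → Y' j i₀ = 0 := by
    intro j hj
    have hrowj : ∀ i, ((1 - N) * Y : Matrix (Fin n) (Fin m) ℂ) j i = Y j i := by
      intro i
      rw [Matrix.sub_mul, Matrix.one_mul, Matrix.sub_apply, hNY, if_neg hj.ne', sub_zero]
    have hmv : (((1 - N) * Y) *ᵥ β) j = (Y *ᵥ β) j := by
      simp only [Matrix.mulVec, dotProduct, hrowj]
    rw [hY', Matrix.mul_add, Matrix.mul_one, Matrix.add_apply, hZK, if_pos rfl, hrowj, hmv]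
    obtain ⟨i, rfl, hsi⟩ := hcol j hj
    by_cases hiS : i ∈ S
    · have h := hβ' i hiS
      rw [← Matrix.mulVec_mulVec] at h
      have h2 : (permMat σ *ᵥ (Y *ᵥ β)) i = (Y *ᵥ β) (σ i) := by
        simp [Matrix.mulVec, dotProduct, permMat]
      rw [← h2, h, add_neg_cancel]
    · have hlt : i < i₀ := by
        refine lt_of_le_of_ne (not_lt.1 fun h => hiS ((hmem i).2 ⟨h, hj⟩)) ?_
        rintro rfl
        exact hsi hi₀
      rw [(hp' i hsi).1 i₀ hlt, zero_add, Matrix.mulVec, dotProduct]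
      refine Finset.sum_eq_zero fun i' _ => ?_
      by_cases hi' : i' ∈ S
      · rw [(hp' i hsi).1 i' (hlt.trans ((hmem i').1 hi').1), zero_mul]
      · rw [hβ i' hi', mul_zero]
  refine ⟨1 + K, hb, 1 + N, hc, Y', ?_, ?_, fun ε => ?_⟩
  · rw [Matrix.mul_add, Matrix.add_mul, hXN, hKX, Matrix.mul_one, Matrix.one_mul]
  · rw [hY', ← Matrix.mul_assoc, ← Matrix.mul_assoc]
    have : (1 + N) * (1 - N) = 1 := by
      rw [Matrix.add_mul, Matrix.mul_sub, Matrix.mul_sub, hNN]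
      simp
    rw [this, Matrix.one_mul]
  · rw [mem_LU_diagonal_mul_permMat_iff] at hLU' ⊢
    intro i hi
    by_cases hii : i = i₀
    · subst hii
      exact ⟨hYr, hYc⟩
    · rw [Function.update_of_ne hii] at hi
      exact hLU' i hi

/-- Points of `E` over a scaled partial permutation matrix supported on the graph of `σ` lie in the
closure of `E°_σ`, provided every column to the right of `σ i`, for `i` a zero row, is matched to a
nonzero row or to a later row. -/
lemma mem_closure_Eopen_of_mem_LU {m n : ℕ} (σ : Fin m ↪ Fin n) (s : Fin m → ℂ)
    (hσ : ∀ i, s i = 0 → ∀ j, σ i < j → ∃ i', σ i' = j ∧ (s i' ≠ 0 ∨ i < i'))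
    (Y : Matrix (Fin n) (Fin m) ℂ)
    (hp : ((diagonal s * permMat σ, Y) : LUSpace m n) ∈ LU m n) :
    ((diagonal s * permMat σ, Y) : LUSpace m n) ∈ closure (Eopen σ) := by
  induction hk : ({i | s i = 0} : Finset (Fin m)).card generalizing s Y with
  | zero =>
    have hs : ∀ i, s i ≠ 0 := by
      simpa [Finset.card_eq_zero, Finset.filter_eq_empty_iff] using hk
    exact mem_closure_of_forall_distinct σ (fun Y hY h0 hne => subset_closure <|
      mem_Eopen_of_distinct σ hs hY (fun i => h0 i (hs i))
        fun i i' => hne i i' (hs i) (hs i')) hp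
  | succ k ih =>
    have hne : ({i | s i = 0} : Finset (Fin m)).Nonempty := by
      rw [← Finset.card_pos, hk]; exact k.succ_pos
    obtain ⟨i₀, hi₀, hmax⟩ : ∃ i₀, s i₀ = 0 ∧ ∀ i, i₀ < i → s i ≠ 0 := by
      refine ⟨_, (Finset.mem_filter.1 (Finset.max'_mem _ hne)).2, fun i hi h => ?_⟩
      exact hi.not_ge (Finset.le_max' _ _ (by simpa using h))
    refine mem_closure_of_forall_distinct σ (fun Y hY h0 _ => ?_) hp
    obtain ⟨b, hb, c, hc, Y', hX, hYb, hε⟩ := exists_smul_update_mem_LU σ hi₀ hmax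
      (fun j hj => by
        obtain ⟨i, rfl, hi⟩ := hσ i₀ hi₀ j hj
        exact ⟨i, rfl, hi.elim id (hmax i)⟩) hY
      fun i hi => right_ne_zero_of_mul (h0 i hi)
    refine mem_closure_Eopen_of_smul σ hb hc ?_ hX hYb
    have hγ : Continuous fun ε : ℂ =>
        ((diagonal (Function.update s i₀ ε) * permMat σ, Y') : LUSpace m n) := by
      refine Continuous.prodMk (Continuous.matrix_mul (Continuous.matrix_diagonal ?_)
        continuous_const) continuous_const
      exact continuous_const.update i₀ continuous_id
    have hlim := mem_closure_of_eventually (S := Eopen σ) hγ <| by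
      filter_upwards [self_mem_nhdsWithin] with ε hε0
      have hε0 : ε ≠ 0 := hε0
      have hz : ∀ i, Function.update s i₀ ε i = 0 ↔ s i = 0 ∧ i ≠ i₀ := by
        intro i
        by_cases hi : i = i₀
        · simp [hi, hε0]
        · simp [hi]
      refine ih _ (fun i hi j hj => ?_) Y' (hε ε) ?_
      · obtain ⟨i', rfl, h⟩ := hσ i ((hz i).1 hi).1 j hj
        exact ⟨i', rfl, h.imp_left fun h h' => h ((hz i').1 h').1⟩
      · have : ({i | Function.update s i₀ ε i = 0} : Finset (Fin m))
            = ({i | s i = 0} : Finset (Fin m)).erase i₀ := by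
          ext i
          simp [hz, and_comm]
        rw [this, Finset.card_erase_of_mem (by simpa using hi₀), hk, Nat.add_sub_cancel]
    simpa [Function.update_eq_self_iff, ← hi₀] using hlim

/-- For a general partial permutation matrix `π` (given with an enumeration of its zero rows
and zero columns) and the maximal-rank completion `π̄`, the part of `E` whose first coordinate
lies in `B_- π B_+` is contained in `E_{π̄}`. -/
theorem part_of_E_subset_completion (m n : ℕ) (hm : 1 ≤ m) (hmn : m ≤ n)
    (π : Matrix (Fin m) (Fin n) ℂ)
    (hπ01 : ∀ i j, π i j = 0 ∨ π i j = 1)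
    (hπrow : ∀ (i : Fin m) (j j' : Fin n), π i j = 1 → π i j' = 1 → j = j')
    (hπcol : ∀ (i i' : Fin m) (j : Fin n), π i j = 1 → π i' j = 1 → i = i')
    (k : ℕ) (hk : k ≤ m) (hnk : n - m + k ≤ n)
    (rows : Fin k → Fin m) (hrows : StrictMono rows)
    (hrows0 : ∀ i : Fin m, (∀ j, π i j = 0) ↔ ∃ r, rows r = i)
    (cols : Fin (n - m + k) → Fin n) (hcols : StrictMono cols)
    (hcols0 : ∀ j : Fin n, (∀ i, π i j = 0) ↔ ∃ r, cols r = j)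
    (πb : Fin m ↪ Fin n)
    (hbar : ∀ (i : Fin m) (j : Fin n),
      πb i = j ↔ (π i j = 1 ∨ ∃ r : Fin k, rows r = i ∧
        cols ⟨n - m + (r : ℕ), Nat.add_lt_add_left r.isLt (n - m)⟩ = j)) :
    { p : LUSpace m n | p ∈ LU m n ∧
        ∃ b ∈ Bminus m, ∃ c ∈ Bplus n, p.1 = b * π * c } ⊆ Ecomp πb := by
  rintro ⟨X, Y⟩ ⟨hLU, b, hb, c, hc, hX⟩
  change X = b * π * c at hX
  classical
  set s : Fin m → ℂ := fun i => if ∀ j, π i j = 0 then 0 else 1 with hs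
  have hs0 : ∀ i, s i = 0 ↔ ∀ j, π i j = 0 := fun i => by simp [hs]
  have hπ : π = diagonal s * permMat πb := by
    ext i j
    rw [diagonal_mul, permMat]
    by_cases hi : ∀ j, π i j = 0
    · simp [hs, hi]
    · obtain ⟨j', hj'⟩ := not_forall.1 hi
      have hj1 := (hπ01 i j').resolve_left hj'
      have hbj : πb i = j' := (hbar i j').2 (Or.inl hj1)
      rw [show s i = 1 from if_neg hi, one_mul, hbj]
      split_ifs with h
      · rw [← h, hj1]
      · exact (hπ01 i j).resolve_right fun h1 => h (hπrow i j' j hj1 h1)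
  refine closure_subset_zclosure _ ?_
  have hbu := (Matrix.isUnit_iff_isUnit_det b).1 hb.1
  have hcu := (Matrix.isUnit_iff_isUnit_det c).1 hc.1
  have hci : c⁻¹ ∈ Bplus n :=
    ⟨(Matrix.isUnit_nonsing_inv_iff).2 hc.1, hc.2.inv hc.1⟩
  have hXc : X * c⁻¹ = b * π := by rw [hX, Matrix.mul_nonsing_inv_cancel_right _ _ hcu]
  refine mem_closure_Eopen_of_smul πb hb hci (X' := π) (Y' := c * Y * b) ?_ hXc
    (by rw [Matrix.mul_assoc, Matrix.nonsing_inv_mul_cancel_left _ _ hcu])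
  have hLU' : ((π, c * Y * b) : LUSpace m n) ∈ LU m n := by
    constructor
    · have : π * (c * Y * b) = b⁻¹ * (X * Y) * b := by
        rw [hX]
        simp only [Matrix.mul_assoc, Matrix.nonsing_inv_mul_cancel_left _ _ hbu]
      change LowerTri (π * (c * Y * b))
      rw [this]
      exact ((hb.2.inv hb.1).mul hLU.1).mul hb.2
    · have : c * Y * b * π = c * (Y * X) * c⁻¹ := by
        rw [Matrix.mul_assoc, ← hXc]
        simp only [Matrix.mul_assoc]
      change UpperTri (c * Y * b * π)
      rw [this]
      exact (hc.2.mul hLU.2).mul hci.2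
  rw [hπ] at hLU' ⊢
  refine mem_closure_Eopen_of_mem_LU πb s (fun i hi j hj => ?_) _ hLU'
  by_cases hcol : ∀ i', π i' j = 0
  · obtain ⟨r, hr⟩ := (hrows0 i).1 ((hs0 i).1 hi)
    obtain ⟨q, hq⟩ := (hcols0 j).1 hcol
    have hbi := (hbar i _).2 (Or.inr ⟨r, hr, rfl⟩)
    rw [hbi, ← hq, hcols.lt_iff_lt, Fin.lt_def] at hj
    have hqlt := q.isLt
    simp only at hj
    obtain ⟨r', hr'⟩ : ∃ r' : Fin k, n - m + (r' : ℕ) = q := ⟨⟨q - (n - m), by omega⟩, by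
      simp only; omega⟩
    refine ⟨rows r', (hbar _ j).2 (Or.inr ⟨r', rfl, ?_⟩), Or.inr ?_⟩
    · rw [← hq]
      congr 1
      exact Fin.ext hr'
    · rw [← hr]
      exact hrows (Fin.lt_def.2 (by omega))
  · obtain ⟨i', hi'⟩ := not_forall.1 hcol
    exact ⟨i', (hbar i' j).2 (Or.inl ((hπ01 i' j).resolve_left hi')),
      Or.inl fun h => hi' ((hs0 i').1 h j)⟩
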